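/- Let Q be the standard (positive definite) quadratic form on V = ℝ^n. The algebra homomorphism from the Clifford algebra of the quadratic form (−Q) ⊕ Q on V ⊕ V to the endomorphism algebra End(ΛV), determined by sending the generator (v, w) ∈ V ⊕ V to the operator c(v) + ĉ(w), is well defined (since (c(v)+ĉ(w))² = (−|v|² + |w|²)·Id) and is bijective, i.e. it is an algebra isomorphism Cl(V, −Q) ⊗̂ Cl(V, Q) ≅ End(ΛV). -/

import Mathlib

open scoped RealInnerProductSpace

/-- Exterior multiplication `e ∧ ·` as an endomorphism of the exterior algebra `ΛV`
of `V = ℝⁿ`. -/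
noncomputable def wedgeMul (n : ℕ) (e : EuclideanSpace ℝ (Fin n)) :
    Module.End ℝ (ExteriorAlgebra ℝ (EuclideanSpace ℝ (Fin n))) :=
  LinearMap.mulLeft ℝ (ExteriorAlgebra.ι ℝ e)

/-- Interior multiplication (contraction) `i_e` with respect to the standard inner
product, as an endomorphism of the exterior algebra `ΛV` of `V = ℝⁿ`. -/
noncomputable def intMul (n : ℕ) (e : EuclideanSpace ℝ (Fin n)) :
    Module.End ℝ (ExteriorAlgebra ℝ (EuclideanSpace ℝ (Fin n))) :=
  CliffordAlgebra.contractLeft (Q := (0 : QuadraticForm ℝ (EuclideanSpace ℝ (Fin n))))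
    (innerₗ (EuclideanSpace ℝ (Fin n)) e)

/-- The Clifford action `c(e) = e∧ − i_e`. -/
noncomputable def cOp (n : ℕ) (e : EuclideanSpace ℝ (Fin n)) :
    Module.End ℝ (ExteriorAlgebra ℝ (EuclideanSpace ℝ (Fin n))) :=
  wedgeMul n e - intMul n e

/-- The Clifford action `ĉ(e) = e∧ + i_e`. -/
noncomputable def chatOp (n : ℕ) (e : EuclideanSpace ℝ (Fin n)) :
    Module.End ℝ (ExteriorAlgebra ℝ (EuclideanSpace ℝ (Fin n))) :=
  wedgeMul n e + intMul n e

/-- The standard (positive definite) quadratic form `Q(v) = ⟨v,v⟩` on `ℝⁿ`. -/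
noncomputable def stdQF (n : ℕ) : QuadraticForm ℝ (EuclideanSpace ℝ (Fin n)) :=
  LinearMap.BilinMap.toQuadraticMap (innerₗ (EuclideanSpace ℝ (Fin n)))

/-- The quadratic form `(−Q) ⊕ Q` on `V ⊕ V` for the standard form `Q` on `V = ℝⁿ`. -/
noncomputable def prodQF (n : ℕ) :
    QuadraticForm ℝ (EuclideanSpace ℝ (Fin n) × EuclideanSpace ℝ (Fin n)) :=
  QuadraticMap.prod (-stdQF n) (stdQF n)

/-- The linear map `V ⊕ V → End(ΛV)`, `(v, w) ↦ c(v) + ĉ(w)`. -/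
noncomputable def cliffGen (n : ℕ) :
    EuclideanSpace ℝ (Fin n) × EuclideanSpace ℝ (Fin n) →ₗ[ℝ]
      Module.End ℝ (ExteriorAlgebra ℝ (EuclideanSpace ℝ (Fin n))) :=
  ((LinearMap.mul ℝ (ExteriorAlgebra ℝ (EuclideanSpace ℝ (Fin n)))).comp
      (ExteriorAlgebra.ι ℝ) -
    CliffordAlgebra.contractLeft.comp (innerₗ (EuclideanSpace ℝ (Fin n)))).comp
      (LinearMap.fst ℝ _ _) +
  ((LinearMap.mul ℝ (ExteriorAlgebra ℝ (EuclideanSpace ℝ (Fin n)))).comp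
      (ExteriorAlgebra.ι ℝ) +
    CliffordAlgebra.contractLeft.comp (innerₗ (EuclideanSpace ℝ (Fin n)))).comp
      (LinearMap.snd ℝ _ _)

section Operators

variable {n : ℕ}

local notation "E" => EuclideanSpace ℝ (Fin n)

lemma wedgeMul_apply (e : E) (x : ExteriorAlgebra ℝ E) :
    wedgeMul n e x = ExteriorAlgebra.ι ℝ e * x := rfl

lemma intMul_ι_mul (e v : E) (x : ExteriorAlgebra ℝ E) :
    intMul n e (ExteriorAlgebra.ι ℝ v * x) =
      inner ℝ e v • x - ExteriorAlgebra.ι ℝ v * intMul n e x :=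
  CliffordAlgebra.contractLeft_ι_mul _ _ _

lemma intMul_algebraMap (e : E) (r : ℝ) :
    intMul n e (algebraMap ℝ (ExteriorAlgebra ℝ E) r) = 0 :=
  CliffordAlgebra.contractLeft_algebraMap (Q := (0 : QuadraticForm ℝ E)) _ _

lemma intMul_intMul (e : E) (x : ExteriorAlgebra ℝ E) :
    intMul n e (intMul n e x) = 0 :=
  CliffordAlgebra.contractLeft_contractLeft _ _

lemma intMul_comm (e f : E) (x : ExteriorAlgebra ℝ E) :
    intMul n e (intMul n f x) = -intMul n f (intMul n e x) :=
  CliffordAlgebra.contractLeft_comm _ _ _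

lemma cliffGen_apply (v w : E) : cliffGen n (v, w) = cOp n v + chatOp n w := rfl

lemma cliffGen_eq_wedgeMul_add_intMul (v w : E) :
    cliffGen n (v, w) = wedgeMul n (w + v) + intMul n (w - v) := by
  have h₁ : wedgeMul n (w + v) = wedgeMul n w + wedgeMul n v := by
    ext x; simp [wedgeMul_apply, add_mul]
  have h₂ : intMul n (w - v) = intMul n w - intMul n v := by
    simp [intMul]
  rw [cliffGen_apply, cOp, chatOp, h₁, h₂]
  abel

lemma sq_wedgeMul_add_intMul (e f : E) :
    (wedgeMul n e + intMul n f) * (wedgeMul n e + intMul n f) =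
      algebraMap ℝ (Module.End ℝ (ExteriorAlgebra ℝ E)) (inner ℝ f e) := by
  refine LinearMap.ext fun x => ?_
  simp only [Module.End.mul_apply, LinearMap.add_apply, wedgeMul_apply, intMul_ι_mul,
    intMul_intMul, Module.algebraMap_end_apply, mul_add, ← mul_assoc, ExteriorAlgebra.ι_sq_zero,
    zero_mul]
  abel

lemma prodQF_apply (v w : E) : prodQF n (v, w) = inner ℝ (w - v) (w + v) := by
  simp only [prodQF, QuadraticMap.prod_apply, stdQF, neg_apply,
    LinearMap.BilinMap.toQuadraticMap_apply, innerₗ_apply_apply, inner_sub_left, inner_add_right,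
    real_inner_comm]
  ring

lemma cliffGen_mul_self (x : E × E) :
    cliffGen n x * cliffGen n x =
      algebraMap ℝ (Module.End ℝ (ExteriorAlgebra ℝ E)) (prodQF n x) := by
  obtain ⟨v, w⟩ := x
  rw [cliffGen_eq_wedgeMul_add_intMul, sq_wedgeMul_add_intMul, prodQF_apply]

/-- The number operator `∑ eᵢ ∧ i_{eᵢ}`, acting on `ΛᵏV` as multiplication by `k`. -/
noncomputable def numberOp (n : ℕ) :
    Module.End ℝ (ExteriorAlgebra ℝ (EuclideanSpace ℝ (Fin n))) :=
  ∑ i, wedgeMul n (EuclideanSpace.basisFun (Fin n) ℝ i) *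
    intMul n (EuclideanSpace.basisFun (Fin n) ℝ i)

lemma numberOp_ι_mul (v : E) (x : ExteriorAlgebra ℝ E) :
    numberOp n (ExteriorAlgebra.ι ℝ v * x) =
      ExteriorAlgebra.ι ℝ v * x + ExteriorAlgebra.ι ℝ v * numberOp n x := by
  have hv : ExteriorAlgebra.ι ℝ v = ∑ i, inner ℝ (EuclideanSpace.basisFun (Fin n) ℝ i) v •
      ExteriorAlgebra.ι ℝ (EuclideanSpace.basisFun (Fin n) ℝ i) := by
    conv_lhs => rw [← (EuclideanSpace.basisFun (Fin n) ℝ).sum_repr' v]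
    simp only [map_sum, map_smul]
  have hterm (e : E) : (wedgeMul n e * intMul n e) (ExteriorAlgebra.ι ℝ v * x) =
      (inner ℝ e v • ExteriorAlgebra.ι ℝ e) * x +
        ExteriorAlgebra.ι ℝ v * (wedgeMul n e * intMul n e) x := by
    have hs := eq_neg_of_add_eq_zero_left (ExteriorAlgebra.ι_add_mul_swap (R := ℝ) e v)
    simp only [Module.End.mul_apply, wedgeMul_apply, intMul_ι_mul, mul_sub, ← mul_assoc, hs,
      mul_smul_comm, smul_mul_assoc, neg_mul, sub_neg_eq_add]
  simp only [numberOp, LinearMap.sum_apply, hterm, Finset.sum_add_distrib, Finset.mul_sum,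
    ← Finset.sum_mul]
  rw [← hv]

lemma numberOp_algebraMap (r : ℝ) :
    numberOp n (algebraMap ℝ (ExteriorAlgebra ℝ E) r) = 0 := by
  simp [numberOp, LinearMap.sum_apply, intMul_algebraMap]

lemma numberOp_ιMulti (k : ℕ) (v : Fin k → E) :
    numberOp n (ExteriorAlgebra.ιMulti ℝ k v) = (k : ℝ) • ExteriorAlgebra.ιMulti ℝ k v := by
  induction k with
  | zero => simpa using numberOp_algebraMap (n := n) 1
  | succ k ih =>
    rw [ExteriorAlgebra.ιMulti_succ_apply, numberOp_ι_mul, ih, mul_smul_comm, Nat.cast_succ,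
      add_smul, one_smul, add_comm]

/-- The projection of `ΛV` onto `Λ⁰V`, as a polynomial in the number operator. -/
noncomputable def vacuumProj (n : ℕ) :
    Module.End ℝ (ExteriorAlgebra ℝ (EuclideanSpace ℝ (Fin n))) :=
  Polynomial.aeval (numberOp n)
    (∏ k ∈ Finset.range n, (1 - Polynomial.C ((k : ℝ) + 1)⁻¹ * Polynomial.X))

lemma vacuumProj_of_numberOp_eq_smul {x : ExteriorAlgebra ℝ E} {μ : ℝ}
    (hx : numberOp n x = μ • x) :
    vacuumProj n x = (∏ k ∈ Finset.range n, (1 - ((k : ℝ) + 1)⁻¹ * μ)) • x := by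
  by_cases h0 : x = 0
  · simp [h0]
  · have := Module.End.aeval_apply_of_hasEigenvector (f := numberOp n) (μ := μ) (x := x)
      (p := ∏ k ∈ Finset.range n, (1 - Polynomial.C ((k : ℝ) + 1)⁻¹ * Polynomial.X))
      ⟨Module.End.mem_eigenspace_iff.2 hx, h0⟩
    simpa [vacuumProj, Polynomial.eval_prod] using this

lemma vacuumProj_ιMulti {k : ℕ} (hk : k ≤ n) (v : Fin k → E) :
    vacuumProj n (ExteriorAlgebra.ιMulti ℝ k v) =
      algebraMap ℝ _ (ExteriorAlgebra.algebraMapInv (ExteriorAlgebra.ιMulti ℝ k v)) := by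
  rw [vacuumProj_of_numberOp_eq_smul (numberOp_ιMulti k v)]
  cases k with
  | zero => simp
  | succ k =>
    have hprod : ∏ j ∈ Finset.range n, (1 - ((j : ℝ) + 1)⁻¹ * ((k + 1 : ℕ) : ℝ)) = 0 := by
      refine Finset.prod_eq_zero (Finset.mem_range.2 hk) ?_
      rw [Nat.cast_succ, inv_mul_cancel₀ k.cast_add_one_ne_zero, sub_self]
    have hι : ExteriorAlgebra.algebraMapInv (ExteriorAlgebra.ι ℝ (v 0)) = 0 := by
      simp [ExteriorAlgebra.algebraMapInv]
    rw [hprod, zero_smul, ExteriorAlgebra.ιMulti_succ_apply, map_mul, hι, zero_mul, map_zero]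

lemma vacuumProj_apply (x : ExteriorAlgebra ℝ E) :
    vacuumProj n x = algebraMap ℝ _ (ExteriorAlgebra.algebraMapInv x) := by
  have key : vacuumProj n = (Algebra.linearMap ℝ (ExteriorAlgebra ℝ E)) ∘ₗ
      (ExteriorAlgebra.algebraMapInv (R := ℝ) (M := E)).toLinearMap := by
    refine (EuclideanSpace.basisFun (Fin n) ℝ).toBasis.ExteriorAlgebra.ext fun s => ?_
    rw [ExteriorAlgebra.basis_apply_ofCard _ (rfl : s.card = s.card),
      ExteriorAlgebra.ιMulti_family, vacuumProj_ιMulti (by simpa using s.card_le_univ)]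
    rfl
  simp [key]

/-- Elements killed by every `m`-fold contraction. -/
noncomputable def contractionKer (n : ℕ) :
    ℕ → Submodule ℝ (ExteriorAlgebra ℝ (EuclideanSpace ℝ (Fin n)))
  | 0 => ⊥
  | m + 1 => ⨅ v, (contractionKer n m).comap (intMul n v)

lemma mem_contractionKer_succ {m : ℕ} {x : ExteriorAlgebra ℝ E} :
    x ∈ contractionKer n (m + 1) ↔ ∀ v, intMul n v x ∈ contractionKer n m := by
  simp [contractionKer, Submodule.mem_iInf]

lemma contractionKer_mono : Monotone (contractionKer n) := by
  refine monotone_nat_of_le_succ fun m => ?_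
  induction m with
  | zero => exact bot_le
  | succ m ih =>
    exact fun x hx => mem_contractionKer_succ.2 fun v => ih (mem_contractionKer_succ.1 hx v)

lemma ι_mul_mem_contractionKer (v : E) {m : ℕ} {x : ExteriorAlgebra ℝ E}
    (hx : x ∈ contractionKer n m) :
    ExteriorAlgebra.ι ℝ v * x ∈ contractionKer n (m + 1) := by
  induction m generalizing x with
  | zero =>
    obtain rfl : x = 0 := hx
    simp
  | succ m ih =>
    refine mem_contractionKer_succ.2 fun w => ?_
    rw [intMul_ι_mul]
    exact sub_mem (Submodule.smul_mem _ _ hx) (ih (mem_contractionKer_succ.1 hx w))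

lemma exists_mem_contractionKer (x : ExteriorAlgebra ℝ E) : ∃ m, x ∈ contractionKer n m := by
  induction x using CliffordAlgebra.left_induction with
  | algebraMap r =>
    refine ⟨1, mem_contractionKer_succ.2 fun v => ?_⟩
    exact (Submodule.mem_bot ℝ).2 (intMul_algebraMap v r)
  | add x y hx hy =>
    obtain ⟨k, hk⟩ := hx
    obtain ⟨m, hm⟩ := hy
    exact ⟨max k m, add_mem (contractionKer_mono (le_max_left _ _) hk)
      (contractionKer_mono (le_max_right _ _) hm)⟩
  | ι_mul x v hx =>
    obtain ⟨m, hm⟩ := hx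
    exact ⟨m + 1, ι_mul_mem_contractionKer v hm⟩

/-- A contraction-stable subspace of `ΛV` on which the degree-zero component vanishes is zero. -/
lemma eq_zero_of_mem_of_intMul_mem {K : Submodule ℝ (ExteriorAlgebra ℝ E)}
    (hK : ∀ v, ∀ x ∈ K, intMul n v x ∈ K)
    (hε : ∀ x ∈ K, ExteriorAlgebra.algebraMapInv x = 0)
    {x : ExteriorAlgebra ℝ E} (hx : x ∈ K) : x = 0 := by
  obtain ⟨m, hm⟩ := exists_mem_contractionKer x
  induction m generalizing x with
  | zero => exact hm
  | succ m ih =>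
    have h0 : numberOp n x = (0 : ℝ) • x := by
      simp only [numberOp, LinearMap.sum_apply, Module.End.mul_apply, zero_smul]
      exact Finset.sum_eq_zero fun i _ => by
        rw [ih (hK _ x hx) (mem_contractionKer_succ.1 hm _), map_zero]
    have h1 := vacuumProj_of_numberOp_eq_smul h0
    rw [vacuumProj_apply, hε x hx] at h1
    simpa using h1.symm

lemma wedgeMul_mem_of_cliffGen_mem {A : Subalgebra ℝ (Module.End ℝ (ExteriorAlgebra ℝ E))}
    (hA : ∀ x, cliffGen n x ∈ A) (e : E) : wedgeMul n e ∈ A := by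
  have h := hA ((2⁻¹ : ℝ) • e, (2⁻¹ : ℝ) • e)
  rwa [cliffGen_eq_wedgeMul_add_intMul, sub_self, ← add_smul, intMul, map_zero, map_zero,
    add_zero, show (2⁻¹ + 2⁻¹ : ℝ) = 1 by norm_num, one_smul] at h

lemma intMul_mem_of_cliffGen_mem {A : Subalgebra ℝ (Module.End ℝ (ExteriorAlgebra ℝ E))}
    (hA : ∀ x, cliffGen n x ∈ A) (e : E) : intMul n e ∈ A := by
  have h := sub_mem (hA (0, e)) (wedgeMul_mem_of_cliffGen_mem hA e)
  rwa [cliffGen_eq_wedgeMul_add_intMul, sub_zero, add_zero, add_sub_cancel_left] at h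

lemma mulLeft_mem_of_wedgeMul_mem {A : Subalgebra ℝ (Module.End ℝ (ExteriorAlgebra ℝ E))}
    (hA : ∀ e, wedgeMul n e ∈ A) (x : ExteriorAlgebra ℝ E) : LinearMap.mulLeft ℝ x ∈ A := by
  induction x using CliffordAlgebra.left_induction with
  | algebraMap r =>
    convert A.algebraMap_mem r using 1
    ext y
    simp [Algebra.smul_def]
  | add x y hx hy =>
    convert add_mem hx hy using 1
    ext z
    simp [add_mul]
  | ι_mul x v hx =>
    convert mul_mem (hA v) hx using 1
    exact LinearMap.mulLeft_mul ℝ (ExteriorAlgebra ℝ E) (ExteriorAlgebra.ι ℝ v) x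

instance finiteDimensional_exteriorAlgebra {V : Type*} [AddCommGroup V] [Module ℝ V]
    [FiniteDimensional ℝ V] : FiniteDimensional ℝ (ExteriorAlgebra ℝ V) :=
  (Module.finBasis ℝ V).ExteriorAlgebra.finiteDimensional_of_finite

lemma finrank_exteriorAlgebra {V : Type*} [AddCommGroup V] [Module ℝ V] [FiniteDimensional ℝ V] :
    Module.finrank ℝ (ExteriorAlgebra ℝ V) = 2 ^ Module.finrank ℝ V := by
  rw [Module.finrank_eq_card_basis (Module.finBasis ℝ V).ExteriorAlgebra]
  simp

/-- A subalgebra of `End(ΛV)` containing the Clifford generators is everything. -/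
lemma eq_top_of_cliffGen_mem {A : Subalgebra ℝ (Module.End ℝ (ExteriorAlgebra ℝ E))}
    (hA : ∀ x, cliffGen n x ∈ A) : A = ⊤ := by
  have hw := wedgeMul_mem_of_cliffGen_mem hA
  have hi := intMul_mem_of_cliffGen_mem hA
  let b := (EuclideanSpace.basisFun (Fin n) ℝ).toBasis.ExteriorAlgebra
  have hP : vacuumProj n ∈ A := by
    refine Algebra.adjoin_le (S := A) (Set.singleton_subset_iff.2 ?_)
      (Polynomial.aeval_mem_adjoin_singleton ℝ (numberOp n))
    exact sum_mem fun i _ => mul_mem (hw _) (hi _)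
  let ε : Module.Dual ℝ (ExteriorAlgebra ℝ E) := ExteriorAlgebra.algebraMapInv.toLinearMap
  -- The functionals `f` all of whose rank-one operators `y ↦ f y • x` lie in `A`.
  let F : Submodule ℝ (Module.Dual ℝ (ExteriorAlgebra ℝ E)) :=
    { carrier := {f | ∀ x, f.smulRight x ∈ A}
      zero_mem' := fun x => by
        convert A.zero_mem using 1
        ext y; simp
      add_mem' := fun {f g} hf hg x => by
        convert add_mem (hf x) (hg x) using 1
        ext y; simp [add_smul]
      smul_mem' := fun r f hf x => by
        convert A.smul_mem (hf x) r using 1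
        ext y; simp [mul_smul] }
  have hεF : ε ∈ F := fun x => by
    convert mul_mem (mulLeft_mem_of_wedgeMul_mem hw x) hP using 1
    refine LinearMap.ext fun y => ?_
    simp [vacuumProj_apply, ε, Algebra.smul_def, Algebra.commutes]
  have hF : ∀ f ∈ F, ∀ a ∈ A, f ∘ₗ a ∈ F := fun f hf a ha x => mul_mem (hf x) ha
  have hbot : F.dualCoannihilator = ⊥ := by
    refine (Submodule.eq_bot_iff _).2 fun x hx => ?_
    refine eq_zero_of_mem_of_intMul_mem (K := F.dualCoannihilator) (fun v y hy => ?_)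
      (fun y hy => ?_) hx
    · rw [Submodule.mem_dualCoannihilator] at hy ⊢
      exact fun f hf => hy _ (hF f hf _ (hi v))
    · exact (Submodule.mem_dualCoannihilator _).1 hy ε hεF
  have htop : F = ⊤ := by
    rw [← Subspace.dualCoannihilator_dualAnnihilator_eq (W := F), hbot,
      Submodule.dualAnnihilator_bot]
  refine eq_top_iff.2 fun T _ => ?_
  have hT : T = ∑ s, (b.coord s).smulRight (T (b s)) := by
    refine b.ext fun t => ?_
    simp [LinearMap.sum_apply, Finsupp.single_apply]
  rw [hT]
  refine sum_mem fun s _ => ?_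
  have hs : b.coord s ∈ F := htop ▸ Submodule.mem_top
  exact hs _

lemma finrank_cliffordAlgebra_prodQF :
    Module.finrank ℝ (CliffordAlgebra (prodQF n)) =
      Module.finrank ℝ (Module.End ℝ (ExteriorAlgebra ℝ E)) := by
  rw [(CliffordAlgebra.equivExterior (prodQF n)).finrank_eq, Module.finrank_linearMap,
    finrank_exteriorAlgebra, finrank_exteriorAlgebra, Module.finrank_prod, pow_add]

end Operators

/-- the generator map `(v, w) ↦ c(v) + ĉ(w)` satisfies the Clifford relation
for the quadratic form `(−Q) ⊕ Q` on `V ⊕ V` (so the induced algebra homomorphism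
`Cl(V, −Q) ⊗̂ Cl(V, Q) → End(ΛV)` is well defined), and this homomorphism is bijective,
i.e. an algebra isomorphism. -/
theorem clifford_iso_end_exterior (n : ℕ) :
    (∀ v w : EuclideanSpace ℝ (Fin n), cliffGen n (v, w) = cOp n v + chatOp n w) ∧
    (∀ x : EuclideanSpace ℝ (Fin n) × EuclideanSpace ℝ (Fin n),
      cliffGen n x * cliffGen n x
        = algebraMap ℝ (Module.End ℝ (ExteriorAlgebra ℝ (EuclideanSpace ℝ (Fin n))))
            (prodQF n x)) ∧
    ∀ h : (∀ x : EuclideanSpace ℝ (Fin n) × EuclideanSpace ℝ (Fin n),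
      cliffGen n x * cliffGen n x
        = algebraMap ℝ (Module.End ℝ (ExteriorAlgebra ℝ (EuclideanSpace ℝ (Fin n))))
            (prodQF n x)),
      Function.Bijective (CliffordAlgebra.lift (prodQF n) ⟨cliffGen n, h⟩) := by
  refine ⟨cliffGen_apply, cliffGen_mul_self, fun h => ?_⟩
  have hsurj : Function.Surjective (CliffordAlgebra.lift (prodQF n) ⟨cliffGen n, h⟩) := by
    rw [← AlgHom.range_eq_top]
    exact eq_top_of_cliffGen_mem fun x =>
      ⟨CliffordAlgebra.ι (prodQF n) x, CliffordAlgebra.lift_ι_apply _ _ _⟩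
  have : FiniteDimensional ℝ (CliffordAlgebra (prodQF n)) :=
    (CliffordAlgebra.equivExterior (prodQF n)).symm.finiteDimensional
  exact ⟨(LinearMap.injective_iff_surjective_of_finrank_eq_finrank
    (f := (CliffordAlgebra.lift (prodQF n) ⟨cliffGen n, h⟩).toLinearMap)
    finrank_cliffordAlgebra_prodQF).2 hsurj, hsurj⟩
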